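/- Let (A, L) be a random financial network, b > 0, and let U ∈ ℝ satisfy ρ_b(A, L) < U < +∞. Then ρ_b(A, L) = inf{ Σ_i Y_i : Y ∈ 𝒞, Y_i(ω) ≤ U for all i and ω, and η(Λ(A+Y, L)) ≤ b }; that is, restricting the infimum to allocations bounded componentwise by U does not change its value. -/

import Mathlib

open MeasureTheory

/-- Total liability vector: `ℓ̄_i = ∑_j ℓ_{ij}`. -/
noncomputable def lbar {N : ℕ} (ℓ : Fin N → Fin N → ℝ) : Fin N → ℝ := fun i => ∑ j, ℓ i j

/-- Relative liability matrix: `π_{ij} = ℓ_{ij}/ℓ̄_i` if `ℓ̄_i > 0`, else `0`. -/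
noncomputable def relPi {N : ℕ} (ℓ : Fin N → Fin N → ℝ) : Fin N → Fin N → ℝ :=
  fun i j => if 0 < lbar ℓ i then ℓ i j / lbar ℓ i else 0

/-- The Eisenberg–Noe clearing map `Φ(p, a, π, ℓ̄) = (πᵀp + a) ∧ ℓ̄`. -/
noncomputable def Phi {N : ℕ} (π : Fin N → Fin N → ℝ) (a lb p : Fin N → ℝ) : Fin N → ℝ :=
  fun i => min ((∑ j, π j i * p j) + a i) (lb i)

/-- The clearing vector `CV(a, ℓ)`: the (for `a ∈ ℝ^N_{++}` unique) nonnegative fixed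
point of the clearing map associated with the liability matrix `ℓ`. -/
noncomputable def clearingVec {N : ℕ} (a : Fin N → ℝ) (ℓ : Fin N → Fin N → ℝ) : Fin N → ℝ :=
  Classical.epsilon fun p => (∀ i, 0 ≤ p i) ∧ Phi (relPi ℓ) a (lbar ℓ) p = p

/-- The Eisenberg–Noe aggregation function `Λ(a, ℓ) = ∑_i (ℓ̄_i − CV_i(a, ℓ))`. -/
noncomputable def aggLoss {N : ℕ} (a : Fin N → ℝ) (ℓ : Fin N → Fin N → ℝ) : ℝ :=
  ∑ i, (lbar ℓ i - clearingVec a ℓ i)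

/-- The feasible total bailout-capital levels: constants `c` such that some admissible
random allocation `Y ∈ 𝒞` with `∑ᵢ Yᵢ = c` a.s. makes the system acceptable. -/
noncomputable def feas {Ω : Type*} [MeasurableSpace Ω] (P : Measure Ω) {N : ℕ}
    (η : (Ω → ℝ) → ℝ) (A : Ω → Fin N → ℝ) (L : Ω → Fin N → Fin N → ℝ) (b : ℝ) : Set ℝ :=
  {c : ℝ | ∃ Y : Ω → Fin N → ℝ, Measurable Y ∧ (∀ ω i, 0 ≤ Y ω i) ∧
    (∀ᵐ ω ∂P, ∑ i, Y ω i = c) ∧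
    η (fun ω => aggLoss (fun i => A ω i + Y ω i) (L ω)) ≤ b}

/-- The systemic risk measure `ρ_b(A, L)`. -/
noncomputable def sysRisk {Ω : Type*} [MeasurableSpace Ω] (P : Measure Ω) {N : ℕ}
    (η : (Ω → ℝ) → ℝ) (A : Ω → Fin N → ℝ) (L : Ω → Fin N → Fin N → ℝ) (b : ℝ) : ℝ :=
  sInf (feas P η A L b)

theorem Phi_mono {N : ℕ} {π : Fin N → Fin N → ℝ} (hπ : ∀ i j, 0 ≤ π i j)
    (a lb : Fin N → ℝ) : Monotone (Phi π a lb) := by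
  intro p q hpq i
  refine min_le_min_right _ (add_le_add_left (Finset.sum_le_sum fun j _ => ?_) _)
  exact mul_le_mul_of_nonneg_left (hpq j) (hπ j i)

theorem continuous_Phi {N : ℕ} (π : Fin N → Fin N → ℝ) (a lb : Fin N → ℝ) :
    Continuous (Phi π a lb) := by
  unfold Phi
  fun_prop

theorem lbar_nonneg {N : ℕ} {ℓ : Fin N → Fin N → ℝ} (hℓ : ∀ i j, 0 ≤ ℓ i j) (i : Fin N) :
    0 ≤ lbar ℓ i :=
  Finset.sum_nonneg fun j _ => hℓ i j

theorem relPi_nonneg {N : ℕ} {ℓ : Fin N → Fin N → ℝ} (hℓ : ∀ i j, 0 ≤ ℓ i j) (i j : Fin N) :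
    0 ≤ relPi ℓ i j := by
  unfold relPi
  split_ifs with h
  · exact div_nonneg (hℓ i j) h.le
  · exact le_rfl

theorem sum_relPi_of_pos {N : ℕ} {ℓ : Fin N → Fin N → ℝ} {i : Fin N} (h : 0 < lbar ℓ i) :
    ∑ j, relPi ℓ i j = 1 := by
  simp only [relPi, if_pos h, ← Finset.sum_div]
  exact div_self h.ne'

/-- Iterates of the clearing map started at the total liabilities; they decrease to the greatest
clearing vector. -/
noncomputable def clearingIter {N : ℕ} (a : Fin N → ℝ) (ℓ : Fin N → Fin N → ℝ) (n : ℕ) :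
    Fin N → ℝ :=
  (Phi (relPi ℓ) a (lbar ℓ))^[n] (lbar ℓ)

theorem clearingIter_succ {N : ℕ} (a : Fin N → ℝ) (ℓ : Fin N → Fin N → ℝ) (n : ℕ) :
    clearingIter a ℓ (n + 1) = Phi (relPi ℓ) a (lbar ℓ) (clearingIter a ℓ n) :=
  Function.iterate_succ_apply' _ _ _

theorem antitone_clearingIter {N : ℕ} {ℓ : Fin N → Fin N → ℝ} (hℓ : ∀ i j, 0 ≤ ℓ i j)
    (a : Fin N → ℝ) : Antitone (clearingIter a ℓ) :=
  (Phi_mono (relPi_nonneg hℓ) a (lbar ℓ)).antitone_iterate_of_map_le fun _ => min_le_right _ _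

theorem le_clearingIter {N : ℕ} {a : Fin N → ℝ} {ℓ : Fin N → Fin N → ℝ} (hℓ : ∀ i j, 0 ≤ ℓ i j)
    {p : Fin N → ℝ} (hp : p ≤ lbar ℓ) (hp' : p ≤ Phi (relPi ℓ) a (lbar ℓ) p) (n : ℕ) :
    p ≤ clearingIter a ℓ n := by
  induction n with
  | zero => exact hp
  | succ n ih =>
    rw [clearingIter_succ]
    exact hp'.trans (Phi_mono (relPi_nonneg hℓ) a (lbar ℓ) ih)

theorem zero_le_Phi_zero {N : ℕ} {a : Fin N → ℝ} {ℓ : Fin N → Fin N → ℝ}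
    (hℓ : ∀ i j, 0 ≤ ℓ i j) (ha : ∀ i, 0 < a i) : 0 ≤ Phi (relPi ℓ) a (lbar ℓ) 0 := by
  intro i
  simpa [Phi] using ⟨(ha i).le, lbar_nonneg hℓ i⟩

theorem exists_tendsto_clearingIter {N : ℕ} {a : Fin N → ℝ} {ℓ : Fin N → Fin N → ℝ}
    (hℓ : ∀ i j, 0 ≤ ℓ i j) (ha : ∀ i, 0 < a i) :
    ∃ q : Fin N → ℝ, Filter.Tendsto (clearingIter a ℓ) Filter.atTop (nhds q) ∧
      (∀ i, 0 ≤ q i) ∧ Phi (relPi ℓ) a (lbar ℓ) q = q := by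
  have h0 : ∀ n, 0 ≤ clearingIter a ℓ n :=
    le_clearingIter hℓ (lbar_nonneg hℓ) (zero_le_Phi_zero hℓ ha)
  have hlim : Filter.Tendsto (clearingIter a ℓ) Filter.atTop
      (nhds fun i => ⨅ n, clearingIter a ℓ n i) := by
    rw [tendsto_pi_nhds]
    intro i
    refine tendsto_atTop_ciInf (fun m n hmn => antitone_clearingIter hℓ a hmn i) ⟨0, ?_⟩
    rintro _ ⟨n, rfl⟩
    exact h0 n i
  refine ⟨_, hlim, fun i => le_ciInf fun n => h0 n i, ?_⟩
  have h1 := ((continuous_Phi (relPi ℓ) a (lbar ℓ)).tendsto _).comp hlim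
  have h2 := hlim.comp (Filter.tendsto_add_atTop_nat 1)
  refine tendsto_nhds_unique h1 (h2.congr fun n => ?_)
  exact clearingIter_succ a ℓ n

/-- The total inflow `πᵀp` of interbank payments equals the total payment made under a clearing
vector `p`. -/
theorem sum_inflow_eq_of_isFixedPt {N : ℕ} {a : Fin N → ℝ} {ℓ : Fin N → Fin N → ℝ}
    {p : Fin N → ℝ} (hp0 : ∀ i, 0 ≤ p i) (hp : Phi (relPi ℓ) a (lbar ℓ) p = p) :
    ∑ i, ∑ j, relPi ℓ j i * p j = ∑ j, p j := by
  rw [Finset.sum_comm]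
  refine Finset.sum_congr rfl fun j _ => ?_
  rw [← Finset.sum_mul]
  by_cases h : 0 < lbar ℓ j
  · rw [sum_relPi_of_pos h, one_mul]
  · have : p j ≤ lbar ℓ j := by
      rw [← congrFun hp j]
      exact min_le_right _ _
    have hpj : p j = 0 := le_antisymm (this.trans (not_lt.mp h)) (hp0 j)
    simp [hpj]

theorem eq_of_le_of_isFixedPt {N : ℕ} {a : Fin N → ℝ} {ℓ : Fin N → Fin N → ℝ}
    (hℓ : ∀ i j, 0 ≤ ℓ i j) (ha : ∀ i, 0 < a i) {p q : Fin N → ℝ}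
    (hp0 : ∀ i, 0 ≤ p i) (hp : Phi (relPi ℓ) a (lbar ℓ) p = p)
    (hq : Phi (relPi ℓ) a (lbar ℓ) q = q) (hpq : p ≤ q) : p = q := by
  have hπ := relPi_nonneg hℓ
  have hq0 : ∀ i, 0 ≤ q i := fun i => (hp0 i).trans (hpq i)
  have hp_min : ∀ i, min ((∑ j, relPi ℓ j i * p j) + a i) (lbar ℓ i) = p i := congrFun hp
  have hq_min : ∀ i, min ((∑ j, relPi ℓ j i * q j) + a i) (lbar ℓ i) = q i := congrFun hq
  have hq_le : ∀ i, q i ≤ lbar ℓ i := fun i => by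
    rw [← hq_min i]
    exact min_le_right _ _
  have h_inflow_mono : ∀ i, ∑ j, relPi ℓ j i * p j ≤ ∑ j, relPi ℓ j i * q j := fun i =>
    Finset.sum_le_sum fun j _ => mul_le_mul_of_nonneg_left (hpq j) (hπ j i)
  have h_surplus_mono : ∀ i, (∑ j, relPi ℓ j i * p j) - p i ≤ (∑ j, relPi ℓ j i * q j) - q i := by
    intro i
    have h1 := hp_min i
    have h2 := hq_min i
    have h3 := h_inflow_mono i
    rcases min_cases ((∑ j, relPi ℓ j i * p j) + a i) (lbar ℓ i) with h | h <;>
    rcases min_cases ((∑ j, relPi ℓ j i * q j) + a i) (lbar ℓ i) with h' | h' <;>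
    linarith
  have h_surplus : ∀ i, (∑ j, relPi ℓ j i * p j) - p i = (∑ j, relPi ℓ j i * q j) - q i := by
    have hsum : ∑ i, ((∑ j, relPi ℓ j i * p j) - p i) =
        ∑ i, ((∑ j, relPi ℓ j i * q j) - q i) := by
      rw [Finset.sum_sub_distrib, Finset.sum_sub_distrib, sum_inflow_eq_of_isFixedPt hp0 hp,
        sum_inflow_eq_of_isFixedPt hq0 hq, sub_self, sub_self]
    intro i
    exact (Finset.sum_eq_sum_iff_of_le fun i _ => h_surplus_mono i).mp hsum i (Finset.mem_univ i)
  by_contra hne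
  obtain ⟨i₀, hi₀⟩ := Function.ne_iff.mp hne
  set S := Finset.univ.filter fun i => p i < q i with hS
  have hS_mem : ∀ i, i ∈ S ↔ p i < q i := fun i => by simp [hS]
  have hS_ne : S.Nonempty := ⟨i₀, (hS_mem i₀).mpr (lt_of_le_of_ne (hpq i₀) hi₀)⟩
  have h_default : ∀ i ∈ S, (∑ j, relPi ℓ j i * p j) + a i = p i := by
    intro i hi
    have h1 := hp_min i
    have h2 := hq_le i
    have h3 := (hS_mem i).mp hi
    rcases min_cases ((∑ j, relPi ℓ j i * p j) + a i) (lbar ℓ i) with h | h <;> linarith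
  -- The gap `q - p` is carried by `S`, and `π` preserves its mass, so `S` is closed under `π`.
  have h_gap : ∑ i ∈ S, (q i - p i) = ∑ j ∈ S, (∑ i ∈ S, relPi ℓ j i) * (q j - p j) := by
    simp only [Finset.sum_mul]
    rw [Finset.sum_comm]
    refine Finset.sum_congr rfl fun i _ => ?_
    have h1 : q i - p i = ∑ j, relPi ℓ j i * (q j - p j) := by
      simp only [mul_sub, Finset.sum_sub_distrib]
      linarith [h_surplus i]
    rw [h1]
    refine (Finset.sum_subset (Finset.subset_univ S) fun j _ hj => ?_).symm
    have : p j = q j := le_antisymm (hpq j) (not_lt.mp fun h => hj ((hS_mem j).mpr h))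
    simp [this]
  have h_row_le : ∀ j ∈ S, ∑ i ∈ S, relPi ℓ j i ≤ 1 := by
    intro j hj
    have hpos : 0 < lbar ℓ j := by linarith [(hS_mem j).mp hj, hp0 j, hq_le j]
    rw [← sum_relPi_of_pos hpos]
    exact Finset.sum_le_sum_of_subset_of_nonneg (Finset.subset_univ S) fun i _ _ => hπ j i
  have h_row : ∀ j ∈ S, ∑ i ∈ S, relPi ℓ j i = 1 := by
    intro j hj
    have hle : ∀ j ∈ S, (∑ i ∈ S, relPi ℓ j i) * (q j - p j) ≤ q j - p j := fun j hj =>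
      mul_le_of_le_one_left (sub_nonneg.mpr (hpq j)) (h_row_le j hj)
    have h1 := (Finset.sum_eq_sum_iff_of_le hle).mp h_gap.symm j hj
    exact (mul_eq_right₀ (sub_pos.mpr ((hS_mem j).mp hj)).ne').mp h1
  have h_inflow : ∑ i ∈ S, p i ≤ ∑ i ∈ S, ∑ j, relPi ℓ j i * p j := by
    calc ∑ i ∈ S, p i = ∑ j ∈ S, (∑ i ∈ S, relPi ℓ j i) * p j :=
          Finset.sum_congr rfl fun j hj => by rw [h_row j hj, one_mul]
      _ = ∑ i ∈ S, ∑ j ∈ S, relPi ℓ j i * p j := by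
          simp only [Finset.sum_mul]
          exact Finset.sum_comm
      _ ≤ _ := Finset.sum_le_sum fun i _ =>
          Finset.sum_le_sum_of_subset_of_nonneg (Finset.subset_univ S) fun j _ _ =>
            mul_nonneg (hπ j i) (hp0 j)
  have h_total := Finset.sum_congr rfl h_default
  rw [Finset.sum_add_distrib] at h_total
  linarith [Finset.sum_pos (fun i _ => ha i) hS_ne]

theorem clearingVec_spec {N : ℕ} {a : Fin N → ℝ} {ℓ : Fin N → Fin N → ℝ}
    (hℓ : ∀ i j, 0 ≤ ℓ i j) (ha : ∀ i, 0 < a i) :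
    (∀ i, 0 ≤ clearingVec a ℓ i) ∧
      Phi (relPi ℓ) a (lbar ℓ) (clearingVec a ℓ) = clearingVec a ℓ := by
  obtain ⟨q, -, hq⟩ := exists_tendsto_clearingIter hℓ ha
  exact Classical.epsilon_spec
    (p := fun p => (∀ i, 0 ≤ p i) ∧ Phi (relPi ℓ) a (lbar ℓ) p = p) ⟨q, hq⟩

theorem clearingVec_le_lbar {N : ℕ} {a : Fin N → ℝ} {ℓ : Fin N → Fin N → ℝ}
    (hℓ : ∀ i j, 0 ≤ ℓ i j) (ha : ∀ i, 0 < a i) : clearingVec a ℓ ≤ lbar ℓ := by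
  intro i
  rw [← congrFun (clearingVec_spec hℓ ha).2 i]
  exact min_le_right _ _

theorem tendsto_clearingIter_clearingVec {N : ℕ} {a : Fin N → ℝ} {ℓ : Fin N → Fin N → ℝ}
    (hℓ : ∀ i j, 0 ≤ ℓ i j) (ha : ∀ i, 0 < a i) :
    Filter.Tendsto (clearingIter a ℓ) Filter.atTop (nhds (clearingVec a ℓ)) := by
  obtain ⟨q, hlim, -, hq⟩ := exists_tendsto_clearingIter hℓ ha
  obtain ⟨hp0, hp⟩ := clearingVec_spec hℓ ha
  have hle : clearingVec a ℓ ≤ q := ge_of_tendsto' hlim fun n =>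
    le_clearingIter hℓ (clearingVec_le_lbar hℓ ha) hp.ge n
  rwa [eq_of_le_of_isFixedPt hℓ ha hp0 hp hq hle]

theorem aggLoss_nonneg {N : ℕ} {a : Fin N → ℝ} {ℓ : Fin N → Fin N → ℝ}
    (hℓ : ∀ i j, 0 ≤ ℓ i j) (ha : ∀ i, 0 < a i) : 0 ≤ aggLoss a ℓ :=
  Finset.sum_nonneg fun i _ => sub_nonneg.mpr (clearingVec_le_lbar hℓ ha i)

theorem aggLoss_le_sum_lbar {N : ℕ} {a : Fin N → ℝ} {ℓ : Fin N → Fin N → ℝ}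
    (hℓ : ∀ i j, 0 ≤ ℓ i j) (ha : ∀ i, 0 < a i) : aggLoss a ℓ ≤ ∑ i, lbar ℓ i :=
  Finset.sum_le_sum fun i _ => sub_le_self _ ((clearingVec_spec hℓ ha).1 i)

section Measurability

variable {Ω : Type*} [MeasurableSpace Ω] {N : ℕ} {A : Ω → Fin N → ℝ} {L : Ω → Fin N → Fin N → ℝ}

theorem measurable_lbar : Measurable (lbar : (Fin N → Fin N → ℝ) → Fin N → ℝ) := by
  unfold lbar
  fun_prop

theorem measurable_relPi :
    Measurable (relPi : (Fin N → Fin N → ℝ) → Fin N → Fin N → ℝ) := by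
  refine measurable_pi_lambda _ fun i => measurable_pi_lambda _ fun j => ?_
  have hi : Measurable fun ℓ : Fin N → Fin N → ℝ => lbar ℓ i :=
    (measurable_pi_apply i).comp measurable_lbar
  exact Measurable.ite (measurableSet_lt measurable_const hi)
    (Measurable.div (by fun_prop) hi) measurable_const

theorem measurable_clearingIter (hA : Measurable A) (hL : Measurable L) (n : ℕ) :
    Measurable fun ω => clearingIter (A ω) (L ω) n := by
  have hlb : Measurable fun ω => lbar (L ω) := measurable_lbar.comp hL
  have hπ : Measurable fun ω => relPi (L ω) := measurable_relPi.comp hL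
  induction n with
  | zero => exact hlb
  | succ n ih =>
    simp only [clearingIter_succ]
    unfold Phi
    fun_prop

theorem measurable_clearingVec (hA : Measurable A) (hL : Measurable L)
    (hApos : ∀ ω i, 0 < A ω i) (hLnn : ∀ ω i j, 0 ≤ L ω i j) :
    Measurable fun ω => clearingVec (A ω) (L ω) :=
  measurable_of_tendsto_metrizable (measurable_clearingIter hA hL) <| tendsto_pi_nhds.mpr
    fun ω => tendsto_clearingIter_clearingVec (hLnn ω) (hApos ω)

theorem integrable_aggLoss {P : Measure Ω} (hA : Measurable A) (hL : Measurable L)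
    (hApos : ∀ ω i, 0 < A ω i) (hLnn : ∀ ω i j, 0 ≤ L ω i j)
    (hLint : Integrable (fun ω => ∑ i, ∑ j, L ω i j) P) :
    Integrable (fun ω => aggLoss (A ω) (L ω)) P := by
  have hCV := measurable_clearingVec hA hL hApos hLnn
  have hlb : Measurable fun ω => lbar (L ω) := measurable_lbar.comp hL
  have hmeas : Measurable fun ω => aggLoss (A ω) (L ω) := by
    unfold aggLoss
    fun_prop
  refine hLint.mono' hmeas.aestronglyMeasurable (Filter.Eventually.of_forall fun ω => ?_)
  rw [Real.norm_of_nonneg (aggLoss_nonneg (hLnn ω) (hApos ω))]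
  exact aggLoss_le_sum_lbar (hLnn ω) (hApos ω)

end Measurability

/-- If `ρ_b(A, L) < U < +∞`, then restricting the infimum defining
`ρ_b(A, L)` to allocations bounded componentwise by `U` does not change its value. -/
theorem sysRisk_eq_inf_over_bounded_allocations
    {Ω : Type*} [MeasurableSpace Ω] (P : Measure Ω) [IsProbabilityMeasure P]
    (N : ℕ) (hN : 1 ≤ N)
    (η : (Ω → ℝ) → ℝ)
    (hη_mono : ∀ X Y : Ω → ℝ, Integrable X P → Integrable Y P →
      (∀ᵐ ω ∂P, X ω ≤ Y ω) → η X ≤ η Y)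
    (hη_conv : ∀ X Y : Ω → ℝ, Integrable X P → Integrable Y P → ∀ t : ℝ, 0 ≤ t → t ≤ 1 →
      η (fun ω => t * X ω + (1 - t) * Y ω) ≤ t * η X + (1 - t) * η Y)
    (hη_norm : η (fun _ => 0) = 0)
    (hη_cont : ∀ ε : ℝ, 0 < ε → ∃ δ : ℝ, 0 < δ ∧ ∀ X Y : Ω → ℝ,
      Integrable X P → Integrable Y P → (∫ ω, |X ω - Y ω| ∂P) < δ → |η X - η Y| < ε)
    (A : Ω → Fin N → ℝ) (hA : Measurable A) (hApos : ∀ ω i, 0 < A ω i)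
    (L : Ω → Fin N → Fin N → ℝ) (hL : Measurable L)
    (hLnn : ∀ ω i j, 0 ≤ L ω i j) (hLdiag : ∀ ω i, L ω i i = 0)
    (hLint : Integrable (fun ω => ∑ i, ∑ j, L ω i j) P)
    (b : ℝ) (hb : 0 < b)
    (U : ℝ) (hU : sysRisk P η A L b < U) :
    sysRisk P η A L b =
      sInf {c : ℝ | ∃ Y : Ω → Fin N → ℝ, Measurable Y ∧ (∀ ω i, 0 ≤ Y ω i) ∧
        (∀ ω i, Y ω i ≤ U) ∧ (∀ᵐ ω ∂P, ∑ i, Y ω i = c) ∧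
        η (fun ω => aggLoss (fun i => A ω i + Y ω i) (L ω)) ≤ b} := by
  set B := {c : ℝ | ∃ Y : Ω → Fin N → ℝ, Measurable Y ∧ (∀ ω i, 0 ≤ Y ω i) ∧
    (∀ ω i, Y ω i ≤ U) ∧ (∀ᵐ ω ∂P, ∑ i, Y ω i = c) ∧
    η (fun ω => aggLoss (fun i => A ω i + Y ω i) (L ω)) ≤ b}
  have hsub : B ⊆ feas P η A L b := fun c ⟨Y, hY, hY0, _, hYc, hYη⟩ => ⟨Y, hY, hY0, hYc, hYη⟩
  have hnn : ∀ c ∈ feas P η A L b, 0 ≤ c := by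
    rintro c ⟨Y, -, hY0, hYc, -⟩
    obtain ⟨ω, hω⟩ := hYc.exists
    exact hω ▸ Finset.sum_nonneg fun i _ => hY0 ω i
  have hmem : ∀ c ∈ feas P η A L b, c < U → c ∈ B := by
    intro c hc hcU
    have hU0 : 0 ≤ U := (hnn c hc).trans hcU.le
    obtain ⟨Y, hY, hY0, hYc, hYη⟩ := hc
    have hY' : Measurable fun ω i => min (Y ω i) U := by fun_prop
    have hY0' : ∀ ω i, 0 ≤ min (Y ω i) U := fun ω i => le_min (hY0 ω i) hU0
    have hae : ∀ᵐ ω ∂P, (fun i => min (Y ω i) U) = Y ω := by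
      filter_upwards [hYc] with ω hω
      funext i
      have h1 : Y ω i ≤ ∑ i, Y ω i :=
        Finset.single_le_sum (fun i _ => hY0 ω i) (Finset.mem_univ i)
      exact min_eq_left (by linarith)
    have hint : ∀ Z : Ω → Fin N → ℝ, Measurable Z → (∀ ω i, 0 ≤ Z ω i) →
        Integrable (fun ω => aggLoss (fun i => A ω i + Z ω i) (L ω)) P := fun Z hZ hZ0 =>
      integrable_aggLoss (by fun_prop) hL (fun ω i => add_pos_of_pos_of_nonneg (hApos ω i) (hZ0 ω i))
        hLnn hLint
    refine ⟨fun ω i => min (Y ω i) U, hY', hY0', fun ω i => min_le_right _ _, ?_, ?_⟩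
    · filter_upwards [hae, hYc] with ω h1 h2
      rw [h1, h2]
    · refine (hη_mono _ _ (hint _ hY' hY0') (hint _ hY hY0) ?_).trans hYη
      filter_upwards [hae] with ω hω
      simp only [congrFun hω, le_refl]
  have hbdd : BddBelow (feas P η A L b) := ⟨0, hnn⟩
  unfold sysRisk at hU ⊢
  rcases (feas P η A L b).eq_empty_or_nonempty with hempty | hne
  · rw [hempty] at hsub ⊢
    rw [Set.subset_empty_iff.mp hsub]
  obtain ⟨c₀, hc₀, hc₀U⟩ := exists_lt_of_csInf_lt hne hU
  have hc₀B := hmem c₀ hc₀ hc₀U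
  refine le_antisymm (csInf_le_csInf hbdd ⟨c₀, hc₀B⟩ hsub) (le_csInf hne fun c hc => ?_)
  rcases lt_or_ge c U with hcU | hcU
  · exact csInf_le (hbdd.mono hsub) (hmem c hc hcU)
  · exact (csInf_le (hbdd.mono hsub) hc₀B).trans (hc₀U.le.trans hcU)
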